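/- Let G be a polynomial with complex coefficients such that G(1/2) = 1 and G(−1/2) = 0. For y > 0 define W̃(y) = (1/(2π)) · ∫_{ℝ} Γ(3 + iu)·G(5/2 + iu)·y^{−(2+iu)}·(2 + iu)^{−1} du, an absolutely convergent integral (this is the contour integral (1/(2πi))∫_{Re(s)=2} Γ(s+1)·G(s+1/2)·y^{−s}·s^{−1} ds). Then there exists a constant C > 0 such that |W̃(y)| ≤ C/y for all y ≥ 1, and |W̃(y) − 1| ≤ C·y for all 0 < y ≤ 1. -/

import Mathlib

open scoped BigOperators

open MeasureTheory Complex Polynomial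

theorem Complex.norm_Gamma_le_Gamma_re {s : ℂ} (hs : 0 < s.re) :
    ‖Gamma s‖ ≤ Real.Gamma s.re := by
  rw [Gamma_eq_integral hs, Real.Gamma_eq_integral hs, GammaIntegral]
  refine (norm_integral_le_integral_norm _).trans_eq
    (setIntegral_congr_fun measurableSet_Ioi fun x hx ↦ ?_)
  simp [norm_cpow_eq_rpow_re_of_pos hx, norm_exp]

theorem Complex.integrable_Gamma_add_I_mul {a : ℝ} (ha : 1 ≤ a) :
    Integrable fun u : ℝ ↦ Gamma (a + I * u) := by
  have hcont : Continuous fun u : ℝ ↦ Gamma (a + I * u) := by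
    rw [continuous_iff_continuousAt]
    intro u
    refine ContinuousAt.comp (g := Gamma)
      (differentiableAt_Gamma _ fun m h ↦ ?_).continuousAt (by fun_prop)
    have := congrArg re h
    simp at this
    have : (0 : ℝ) ≤ m := m.cast_nonneg
    linarith
  refine (integrable_inv_one_add_sq.const_mul (Real.Gamma (a + 2))).mono'
    hcont.aestronglyMeasurable (.of_forall fun u ↦ ?_)
  set s : ℂ := a + I * u with hs
  have hre : s.re = a := by simp [hs]
  have him : s.im = u := by simp [hs]
  have hs0 : s ≠ 0 := fun h ↦ by simp [h] at hre; linarith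
  have hs1 : s + 1 ≠ 0 := fun h ↦ by
    have := congrArg re h
    simp [hre] at this; linarith
  have hrec : Gamma (s + 2) = (s + 1) * (s * Gamma s) := by
    rw [← Gamma_add_one s hs0, ← Gamma_add_one _ hs1]; ring_nf
  have hle : ‖Gamma (s + 2)‖ ≤ Real.Gamma (a + 2) := by
    simpa [hre] using norm_Gamma_le_Gamma_re (s := s + 2) (by simp [hre]; linarith)
  have hsq : 1 + u ^ 2 ≤ ‖s‖ ^ 2 := by
    rw [Complex.sq_norm, normSq_apply, hre, him]; nlinarith
  have hmono : ‖s‖ ≤ ‖s + 1‖ := by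
    rw [← sq_le_sq₀ (norm_nonneg _) (norm_nonneg _), Complex.sq_norm, Complex.sq_norm,
      normSq_apply, normSq_apply]
    simp [hre, him]; nlinarith
  rw [hrec, norm_mul, norm_mul] at hle
  rw [← div_eq_mul_inv, le_div_iff₀ (by positivity)]
  refine le_trans ?_ hle
  nlinarith [norm_nonneg (Gamma s), mul_le_mul_of_nonneg_right hmono (norm_nonneg s),
    mul_le_mul_of_nonneg_right hsq (norm_nonneg (Gamma s)),
    mul_le_mul_of_nonneg_right (mul_le_mul_of_nonneg_right hmono (norm_nonneg s))
      (norm_nonneg (Gamma s))]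

theorem integrable_mul_cpow_vertical {f : ℝ → ℂ} (hf : Integrable f) {y : ℝ} (hy : 0 < y) :
    Integrable fun u : ℝ ↦ f u * (y : ℂ) ^ (-(2 + I * u)) := by
  have hcont : Continuous fun u : ℝ ↦ (y : ℂ) ^ (-(2 + I * u)) :=
    Continuous.const_cpow (by fun_prop) (.inl (by exact_mod_cast hy.ne'))
  refine hf.mul_bdd (c := y ^ (-2 : ℝ)) hcont.aestronglyMeasurable (.of_forall fun u ↦ ?_)
  rw [norm_cpow_eq_rpow_re_of_pos hy]
  simp

theorem integral_Gamma_mul_cpow (k : ℕ) {y : ℝ} (hy : 0 < y) :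
    ∫ u : ℝ, Gamma (2 + k + I * u) * (y : ℂ) ^ (-(2 + I * u)) =
      2 * Real.pi * (y ^ k * Real.exp (-y) : ℝ) := by
  set g : ℝ → ℂ := fun t ↦ (t : ℂ) ^ (k : ℂ) • (Real.exp (-t) : ℂ) with hg
  have hmellin (u : ℝ) : mellin g ((2 : ℝ) + u * I) = Gamma (2 + k + I * u) := by
    rw [hg, mellin_cpow_smul, ← GammaIntegral_eq_mellin, ← Gamma_eq_integral]
    · congr 1; push_cast; ring
    · simp; positivity
  have hconv : MellinConvergent g (2 : ℝ) := by
    rw [hg, MellinConvergent.cpow_smul]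
    have := GammaIntegral_convergent (s := (2 : ℝ) + (k : ℂ)) (by simp; positivity)
    refine this.congr_fun (fun t _ ↦ ?_) measurableSet_Ioi
    simp [mul_comm]
  have hint : VerticalIntegrable (mellin g) 2 := by
    simp_rw [VerticalIntegrable, hmellin]
    simpa using integrable_Gamma_add_I_mul (a := 2 + k) (by linarith [k.cast_nonneg (α := ℝ)])
  have hcont : ContinuousAt g y := by
    simp only [hg, cpow_natCast]; fun_prop
  have key := mellinInv_mellin_eq 2 g hy hconv hint hcont
  simp_rw [mellinInv, hmellin, real_smul] at key
  have hpi : (Real.pi : ℂ) ≠ 0 := by exact_mod_cast Real.pi_ne_zero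
  have hg' : g y = (y ^ k * Real.exp (-y) : ℝ) := by simp [hg]
  rw [← hg', ← key]
  push_cast
  rw [← mul_assoc, mul_one_div_cancel (by simp [hpi]), one_mul]
  refine integral_congr_ae (.of_forall fun u ↦ ?_)
  simp [mul_comm]

theorem pow_mul_exp_neg_le (k : ℕ) {y : ℝ} (hy : 0 < y) :
    y ^ k * Real.exp (-y) ≤ (k + 1).factorial / y := by
  have := Real.pow_div_factorial_le_exp y hy.le (k + 1)
  rw [div_le_iff₀ (by positivity)] at this
  rw [le_div_iff₀ hy, Real.exp_neg, mul_right_comm, ← pow_succ, ← div_eq_mul_inv,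
    div_le_iff₀ (Real.exp_pos _)]
  linarith

/-- The inverse Mellin integral of `f` along the line `Re s = 2`, without its factor `1 / (2π)`,
converges absolutely, is `O(1 / y)` on `(0, ∞)` and is `O(y)` on `(0, 1]`. -/
def HasSmallInverseMellin (f : ℝ → ℂ) : Prop :=
  (∀ y : ℝ, 0 < y → Integrable fun u : ℝ ↦ f u * (y : ℂ) ^ (-(2 + I * u))) ∧
    ∃ C : ℝ, ∀ y : ℝ, 0 < y →
      ‖∫ u : ℝ, f u * (y : ℂ) ^ (-(2 + I * u))‖ ≤ C / y ∧
        (y ≤ 1 → ‖∫ u : ℝ, f u * (y : ℂ) ^ (-(2 + I * u))‖ ≤ C * y)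

namespace HasSmallInverseMellin

theorem add {f g : ℝ → ℂ} (hf : HasSmallInverseMellin f) (hg : HasSmallInverseMellin g) :
    HasSmallInverseMellin fun u ↦ f u + g u := by
  obtain ⟨hfi, C, hC⟩ := hf
  obtain ⟨hgi, D, hD⟩ := hg
  simp only [HasSmallInverseMellin, add_mul]
  refine ⟨fun y hy ↦ (hfi y hy).add (hgi y hy), C + D, fun y hy ↦ ?_⟩
  rw [integral_add (hfi y hy) (hgi y hy), add_div, add_mul]
  exact ⟨(norm_add_le _ _).trans (add_le_add (hC y hy).1 (hD y hy).1),
    fun h ↦ (norm_add_le _ _).trans (add_le_add ((hC y hy).2 h) ((hD y hy).2 h))⟩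

theorem const_mul {f : ℝ → ℂ} (hf : HasSmallInverseMellin f) (a : ℂ) :
    HasSmallInverseMellin fun u ↦ a * f u := by
  obtain ⟨hfi, C, hC⟩ := hf
  simp only [HasSmallInverseMellin, mul_assoc]
  refine ⟨fun y hy ↦ (hfi y hy).const_mul a, ‖a‖ * C, fun y hy ↦ ?_⟩
  rw [integral_const_mul, norm_mul, mul_div_assoc, mul_assoc]
  exact ⟨mul_le_mul_of_nonneg_left (hC y hy).1 (norm_nonneg a),
    fun h ↦ mul_le_mul_of_nonneg_left ((hC y hy).2 h) (norm_nonneg a)⟩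

theorem gamma {k : ℕ} (hk : 1 ≤ k) : HasSmallInverseMellin fun u ↦ Gamma (2 + k + I * u) := by
  refine ⟨fun y hy ↦ integrable_mul_cpow_vertical (by
    simpa using integrable_Gamma_add_I_mul (a := 2 + k)
      (by linarith [k.cast_nonneg (α := ℝ)])) hy,
    2 * Real.pi * ((k + 1).factorial : ℝ), fun y hy ↦ ?_⟩
  have hnorm : ‖(2 * Real.pi * (y ^ k * Real.exp (-y) : ℝ) : ℂ)‖ =
      2 * Real.pi * (y ^ k * Real.exp (-y)) := by
    rw [norm_mul, norm_mul, norm_real, norm_real, Real.norm_of_nonneg Real.pi_nonneg,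
      Real.norm_of_nonneg (by positivity), RCLike.norm_ofNat]
  rw [integral_Gamma_mul_cpow k hy, hnorm, mul_div_assoc, mul_assoc (2 * Real.pi)]
  refine ⟨by gcongr; exact pow_mul_exp_neg_le k hy, fun h ↦ ?_⟩
  have hpow : y ^ k ≤ y := by simpa using pow_le_pow_of_le_one hy.le h hk
  have hexp : Real.exp (-y) ≤ 1 := Real.exp_le_one_iff.mpr (by linarith)
  have hfac : (1 : ℝ) ≤ (k + 1).factorial := by exact_mod_cast (k + 1).factorial_pos
  refine mul_le_mul_of_nonneg_left ?_ (by positivity)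
  calc y ^ k * Real.exp (-y) ≤ y * 1 := by gcongr
    _ = 1 * y := by ring
    _ ≤ (k + 1).factorial * y := by gcongr

theorem gamma_mul_eval (K : ℂ[X]) {k : ℕ} (hk : 1 ≤ k) :
    HasSmallInverseMellin fun u ↦ Gamma (2 + k + I * u) * K.eval (2 + I * u) := by
  induction K using Polynomial.induction_on generalizing k with
  | C a => simpa [mul_comm] using (gamma hk).const_mul a
  | add p q hp hq => simpa [mul_add] using (hp hk).add (hq hk)
  | monomial n a ih =>
    convert (ih (k := k + 1) (by lia)).add ((ih hk).const_mul (-k)) using 2 with u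
    have hne : (2 + k + I * u : ℂ) ≠ 0 := fun h ↦ by
      have := congrArg re h
      simp at this
      linarith [k.cast_nonneg (α := ℝ)]
    have hrec : Gamma (2 + (k + 1 : ℕ) + I * u) = (2 + k + I * u) * Gamma (2 + k + I * u) := by
      rw [← Gamma_add_one _ hne]; push_cast; ring_nf
    rw [hrec]
    simp only [eval_mul, eval_C, eval_pow, eval_X]
    ring

end HasSmallInverseMellin

theorem Polynomial.exists_eq_of_eval_half {G : ℂ[X]} (hG1 : G.eval (1 / 2) = 1)
    (hG2 : G.eval (-(1 / 2)) = 0) :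
    ∃ K : ℂ[X], ∀ s : ℂ, G.eval (s + 1 / 2) = (s + 1) * (1 + s * K.eval s) := by
  obtain ⟨A, rfl⟩ := dvd_iff_isRoot.mpr (show G.IsRoot (-(1 / 2)) from hG2)
  have hA : (A - 1).IsRoot (1 / 2) := by
    simp only [eval_mul, eval_sub, eval_X, eval_C] at hG1
    norm_num at hG1
    rw [IsRoot, eval_sub, hG1, eval_one, sub_self]
  obtain ⟨B, hB⟩ := dvd_iff_isRoot.mpr hA
  obtain rfl : A = 1 + (X - C (1 / 2)) * B := by rw [← hB]; ring
  refine ⟨B.comp (X + C (1 / 2)), fun s ↦ ?_⟩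
  simp only [eval_mul, eval_sub, eval_add, eval_X, eval_C, eval_one, eval_comp]
  ring

/-- for a polynomial G with G(1/2) = 1 and G(−1/2) = 0, the
function W̃(y) = (1/(2π))·∫_ℝ Γ(3+iu)·G(5/2+iu)·y^{−(2+iu)}·(2+iu)⁻¹ du
(an absolutely convergent integral) satisfies |W̃(y)| ≤ C/y for y ≥ 1 and
|W̃(y) − 1| ≤ C·y for 0 < y ≤ 1, for some constant C > 0. -/
theorem stmt_19 (G : Polynomial ℂ) (hG1 : G.eval (1 / 2) = 1)
    (hG2 : G.eval (-(1 / 2)) = 0)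
    (W : ℝ → ℂ)
    (hW : ∀ y : ℝ, 0 < y → W y = (1 / (2 * (Real.pi : ℂ))) *
      ∫ u : ℝ, Complex.Gamma (3 + Complex.I * u) *
        G.eval (5 / 2 + Complex.I * u) * (y : ℂ) ^ (-(2 + Complex.I * u)) *
        (2 + Complex.I * u)⁻¹) :
    (∀ y : ℝ, 0 < y → MeasureTheory.Integrable (fun u : ℝ =>
      Complex.Gamma (3 + Complex.I * u) * G.eval (5 / 2 + Complex.I * u) *
        (y : ℂ) ^ (-(2 + Complex.I * u)) * (2 + Complex.I * u)⁻¹)) ∧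
    ∃ C : ℝ, 0 < C ∧ (∀ y : ℝ, 1 ≤ y → ‖W y‖ ≤ C / y) ∧
      ∀ y : ℝ, 0 < y → y ≤ 1 → ‖W y - 1‖ ≤ C * y := by
  obtain ⟨K, hK⟩ := exists_eq_of_eval_half hG1 hG2
  set r : ℝ → ℂ := fun u ↦ Gamma (2 + (1 : ℕ) + I * u) +
    Gamma (2 + (2 : ℕ) + I * u) * K.eval (2 + I * u) with hr
  obtain ⟨hri, D, hD⟩ : HasSmallInverseMellin r :=
    (HasSmallInverseMellin.gamma le_rfl).add (.gamma_mul_eval K one_le_two)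
  have hsplit (y u : ℝ) : Gamma (3 + I * u) * G.eval (5 / 2 + I * u) *
      (y : ℂ) ^ (-(2 + I * u)) * (2 + I * u)⁻¹ =
      Gamma (2 + (0 : ℕ) + I * u) * (y : ℂ) ^ (-(2 + I * u)) +
        r u * (y : ℂ) ^ (-(2 + I * u)) := by
    set s : ℂ := 2 + I * u with hs
    have hs0 : s ≠ 0 := fun h ↦ by simpa [hs] using congrArg re h
    have hs1 : s + 1 ≠ 0 := fun h ↦ by
      have := congrArg re h
      norm_num [hs] at this
    have e0 : (2 + (0 : ℕ) + I * u : ℂ) = s := by simp [hs]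
    have e1 : (2 + (1 : ℕ) + I * u : ℂ) = s + 1 := by simp [hs]; ring
    have e2 : (2 + (2 : ℕ) + I * u : ℂ) = s + 1 + 1 := by simp [hs]; ring
    have e3 : (3 + I * u : ℂ) = s + 1 := by rw [hs]; ring
    have e4 : (5 / 2 + I * u : ℂ) = s + 1 / 2 := by rw [hs]; ring
    simp only [hr]
    rw [e0, e1, e2, e3, e4, hK, Gamma_add_one _ hs1, Gamma_add_one _ hs0]
    field_simp
    ring
  have hgi (y : ℝ) (hy : 0 < y) :
      Integrable fun u : ℝ ↦ Gamma (2 + (0 : ℕ) + I * u) * (y : ℂ) ^ (-(2 + I * u)) :=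
    integrable_mul_cpow_vertical
      (by simpa using integrable_Gamma_add_I_mul (a := 2) one_le_two) hy
  simp_rw [hsplit] at hW ⊢
  have hWr (y : ℝ) (hy : 0 < y) : W y = (Real.exp (-y) : ℝ) +
      (1 / (2 * (Real.pi : ℂ))) * ∫ u : ℝ, r u * (y : ℂ) ^ (-(2 + I * u)) := by
    have hpi : (Real.pi : ℂ) ≠ 0 := by exact_mod_cast Real.pi_ne_zero
    rw [hW y hy, integral_add (hgi y hy) (hri y hy), integral_Gamma_mul_cpow 0 hy, mul_add]
    congr 1
    rw [pow_zero, one_mul]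
    field_simp
  have hnorm (z : ℂ) : ‖1 / (2 * (Real.pi : ℂ)) * z‖ ≤ ‖z‖ := by
    rw [norm_mul]
    refine mul_le_of_le_one_left (norm_nonneg z) ?_
    simp only [norm_div, norm_mul, norm_real, norm_one, RCLike.norm_ofNat,
      Real.norm_of_nonneg Real.pi_nonneg]
    rw [div_le_one (by positivity)]
    linarith [Real.pi_gt_three]
  refine ⟨fun y hy ↦ (hgi y hy).add (hri y hy), 1 + |D|, by positivity,
    fun y hy ↦ ?_, fun y hy hy1 ↦ ?_⟩
  · have hy0 : 0 < y := by linarith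
    rw [hWr y hy0, add_div]
    refine (norm_add_le _ _).trans (add_le_add ?_ ((hnorm _).trans ((hD y hy0).1.trans ?_)))
    · rw [norm_real, Real.norm_of_nonneg (Real.exp_pos _).le]
      simpa using pow_mul_exp_neg_le 0 hy0
    · gcongr; exact le_abs_self D
  · rw [hWr y hy, add_sub_right_comm, add_mul]
    refine (norm_add_le _ _).trans (add_le_add ?_ ((hnorm _).trans (((hD y hy).2 hy1).trans ?_)))
    · rw [← ofReal_one, ← ofReal_sub, norm_real, Real.norm_eq_abs, abs_le]
      have hexp : Real.exp (-y) ≤ 1 := Real.exp_le_one_iff.mpr (by linarith)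
      constructor <;> linarith [Real.add_one_le_exp (-y)]
    · gcongr; exact le_abs_self D
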